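/- arXiv:1402.7192 — 2 statements merged into one kernel-verified Lean document; each statement's English description precedes it below -/
import Mathlib

section
/- Let 1 ≤ p < ∞ and let f ∈ U_p(ℝ²). Then f ∈ S₀(ℝ²), f is essentially bounded, and there is a constant c depending only on p such that ess sup_{ℝ²} |f| ≤ c (‖φ₁‖_{p,1} + ‖φ₂‖_{p,1}), where φ₁(y) = ‖f_y‖*_{Lip 1/p} and φ₂(x) = ‖f_x‖*_{Lip 1/p}. -/
open MeasureTheory Set
open scoped ENNReal

noncomputable section

/-- Extended essential sup norm on ℝ. -/
def einf (φ : ℝ → ℝ) : ℝ≥0∞ := eLpNorm φ ⊤ volume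

/-- Lipschitz `α` seminorm (extended real valued):
`sup_{h>0} h^{-α} ‖φ(·+h) - φ‖_∞`. -/
def lipSemiE (α : ℝ) (φ : ℝ → ℝ) : ℝ≥0∞ :=
  ⨆ h ∈ Ioi (0:ℝ), ENNReal.ofReal (h ^ (-α)) * einf (fun x => φ (x + h) - φ x)

/-- Real-valued Lipschitz `α` seminorm `‖φ‖*_{Lip α}`. -/
def lipSemi (α : ℝ) (φ : ℝ → ℝ) : ℝ := (lipSemiE α φ).toReal

/-- `φ ∈ Lip α`: essentially bounded with finite Lipschitz `α` seminorm. -/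
def MemLip (α : ℝ) (φ : ℝ → ℝ) : Prop := einf φ < ⊤ ∧ lipSemiE α φ < ⊤

/-- `‖φ‖_{Lip α} = ‖φ‖_∞ + ‖φ‖*_{Lip α}`. -/
def lipNorm (α : ℝ) (φ : ℝ → ℝ) : ℝ := (einf φ + lipSemiE α φ).toReal

/-- The class `S₀`: measurable functions with finite distribution function at every
positive level. -/
def S0 {X : Type*} [MeasureSpace X] (f : X → ℝ) : Prop :=
  Measurable f ∧ ∀ s : ℝ, 0 < s → volume {x | s < |f x|} < ⊤

/-- The non-increasing rearrangement `f*`. -/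
def rearr {X : Type*} [MeasureSpace X] (f : X → ℝ) (t : ℝ) : ℝ :=
  sInf {s : ℝ | 0 ≤ s ∧ volume {x | s < |f x|} ≤ ENNReal.ofReal t}

/-- `f**(t) = (1/t) ∫₀^t f*(u) du`. -/
def doubleStar {X : Type*} [MeasureSpace X] (f : X → ℝ) (t : ℝ) : ℝ :=
  (∫ u in Ioc (0:ℝ) t, rearr f u) / t

/-- Lorentz `L^{p,q}` norm. -/
def lorentzNorm {X : Type*} [MeasureSpace X] (p q : ℝ) (f : X → ℝ) : ℝ :=
  (∫ t in Ioi (0:ℝ), (t ^ (1/p) * rearr f t) ^ q / t) ^ (1/q)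

/-- Membership in the Lorentz space `L^{p,q}`. -/
def MemLorentz {X : Type*} [MeasureSpace X] (p q : ℝ) (f : X → ℝ) : Prop :=
  S0 f ∧ IntegrableOn (fun t => (t ^ (1/p) * rearr f t) ^ q / t) (Ioi (0:ℝ))

/-- The space `U_p(ℝ²)`: a.e. sections in `Lip (1/p)`, with `Lip (1/p)` norms of the
sections in `L^{p,1}(ℝ)`. -/
def MemUp (p : ℝ) (f : ℝ × ℝ → ℝ) : Prop :=
  Measurable f ∧
  (∀ᵐ y : ℝ ∂volume, MemLip (1/p) (fun x => f (x, y))) ∧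
  (∀ᵐ x : ℝ ∂volume, MemLip (1/p) (fun y => f (x, y))) ∧
  MemLorentz p 1 (fun y => lipNorm (1/p) (fun x => f (x, y))) ∧
  MemLorentz p 1 (fun x => lipNorm (1/p) (fun y => f (x, y)))

/-- The Steklov-type average `f_h`. -/
def avg (f : ℝ × ℝ → ℝ) (h : ℝ) (z : ℝ × ℝ) : ℝ :=
  (∫ u in Ioc (0:ℝ) h, ∫ v in Ioc (0:ℝ) h, f (z.1 + u, z.2 + v)) / h ^ 2

lemma ae_abs_le_of_einf_le {φ : ℝ → ℝ} {M : ℝ} (hM : 0 ≤ M) (h : einf φ ≤ ENNReal.ofReal M) :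
    ∀ᵐ x, |φ x| ≤ M := by
  rw [einf, eLpNorm_exponent_top] at h
  filter_upwards [ae_le_eLpNormEssSup (f := φ) (μ := volume)] with x hx
  have h1 := hx.trans h
  rw [Real.enorm_eq_ofReal_abs] at h1
  exact (ENNReal.ofReal_le_ofReal_iff hM).1 h1

lemma ae_abs_sub_le_of_lipSemi_le {α s u : ℝ} {φ : ℝ → ℝ} (hs : 0 ≤ s) (hu : 0 < u)
    (hfin : lipSemiE α φ < ⊤) (h : lipSemi α φ ≤ s) :
    ∀ᵐ x, |φ (x + u) - φ x| ≤ s * u ^ α := by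
  have hE : lipSemiE α φ ≤ ENNReal.ofReal s := ENNReal.le_ofReal_iff_toReal_le hfin.ne hs |>.2 h
  have h1 : ENNReal.ofReal (u ^ (-α)) * einf (fun x => φ (x + u) - φ x) ≤ ENNReal.ofReal s :=
    (le_iSup₂ (f := fun (h : ℝ) (_ : h ∈ Ioi (0:ℝ)) =>
      ENNReal.ofReal (h ^ (-α)) * einf (fun x => φ (x + h) - φ x)) u hu).trans hE
  have hpos : 0 < u ^ α := Real.rpow_pos_of_pos hu α
  refine ae_abs_le_of_einf_le (by positivity) ?_
  calc einf (fun x => φ (x + u) - φ x)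
      = ENNReal.ofReal (u ^ α) *
        (ENNReal.ofReal (u ^ (-α)) * einf (fun x => φ (x + u) - φ x)) := by
        rw [← mul_assoc, ← ENNReal.ofReal_mul hpos.le, ← Real.rpow_add hu]
        simp
    _ ≤ ENNReal.ofReal (u ^ α) * ENNReal.ofReal s := by gcongr
    _ = ENNReal.ofReal (s * u ^ α) := by rw [← ENNReal.ofReal_mul hpos.le, mul_comm]

/-- A `Lip α` function bounded by `M` off a set of measure less than `h` is bounded by
`M + s * h ^ α` almost everywhere. -/
lemma ae_abs_le_of_lipSemi_le {α s h M : ℝ} {φ : ℝ → ℝ} {E : Set ℝ} (hφ : Measurable φ)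
    (hα : 0 < α) (hs : 0 ≤ s) (hfin : lipSemiE α φ < ⊤) (hlip : lipSemi α φ ≤ s)
    (hE : volume Eᶜ < ENNReal.ofReal h) (hM : ∀ᵐ x, x ∈ E → |φ x| ≤ M) :
    ∀ᵐ x, |φ x| ≤ M + s * h ^ α := by
  have hmeas : MeasurableSet {z : ℝ × ℝ | 0 < z.1 → |φ (z.2 + z.1) - φ z.2| ≤ s * z.1 ^ α} := by
    have h1 : MeasurableSet {z : ℝ × ℝ | 0 < z.1} := measurableSet_lt (by fun_prop) (by fun_prop)
    have h2 : MeasurableSet {z : ℝ × ℝ | |φ (z.2 + z.1) - φ z.2| ≤ s * z.1 ^ α} :=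
      measurableSet_le (by fun_prop) (by fun_prop)
    exact h1.imp h2
  have hsw : ∀ᵐ x : ℝ, ∀ᵐ u : ℝ, 0 < u → |φ (x + u) - φ x| ≤ s * u ^ α := by
    rw [← Measure.ae_ae_comm hmeas]
    refine ae_of_all _ fun u => ?_
    by_cases hu : 0 < u
    · filter_upwards [ae_abs_sub_le_of_lipSemi_le hs hu hfin hlip] with x hx _ using hx
    · exact ae_of_all _ fun x hx => absurd hx hu
  filter_upwards [hsw] with x hx
  have hx' : ∀ᵐ z : ℝ, 0 < z - x → |φ z - φ x| ≤ s * (z - x) ^ α := by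
    have := (measurePreserving_sub_right volume x).quasiMeasurePreserving.ae hx
    filter_upwards [this] with z hz h0
    simpa using hz h0
  obtain ⟨z, hzI, hzE, hz1, hz2⟩ : ∃ z ∈ Ioo x (x + h), z ∈ E ∧
      (z ∈ E → |φ z| ≤ M) ∧ (0 < z - x → |φ z - φ x| ≤ s * (z - x) ^ α) := by
    by_contra! hcon
    have hsub : Ioo x (x + h) ⊆ Eᶜ ∪ {z | ¬ ((z ∈ E → |φ z| ≤ M) ∧
        (0 < z - x → |φ z - φ x| ≤ s * (z - x) ^ α))} := by
      intro z hz
      by_cases hzE : z ∈ E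
      · right
        rintro ⟨h1, h2⟩
        obtain ⟨h3, h4⟩ := hcon z hz hzE h1
        exact absurd (h2 h3) (not_le.2 h4)
      · exact Or.inl hzE
    have h0 : volume {z | ¬ ((z ∈ E → |φ z| ≤ M) ∧
        (0 < z - x → |φ z - φ x| ≤ s * (z - x) ^ α))} = 0 := ae_iff.1 (hM.and hx')
    have := (measure_mono hsub).trans (measure_union_le (μ := volume) _ _)
    rw [h0, add_zero, Real.volume_Ioo, add_sub_cancel_left] at this
    exact absurd this (not_le.2 hE)
  have h1 := hz1 hzE
  have h2 := hz2 (by linarith [hzI.1])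
  have h3 : s * (z - x) ^ α ≤ s * h ^ α := by
    gcongr
    · linarith [hzI.1]
    · linarith [hzI.2]
  have h4 := abs_sub_abs_le_abs_sub (φ x) (φ z)
  rw [abs_sub_comm] at h4
  linarith

/-- The set whose infimum is `rearr g t` contains its infimum as soon as it is nonempty. -/
lemma volume_rearr_lt_le {X : Type*} [MeasureSpace X] {g : X → ℝ} {t : ℝ}
    (hne : {s : ℝ | 0 ≤ s ∧ volume {x | s < |g x|} ≤ ENNReal.ofReal t}.Nonempty) :
    volume {x | rearr g t < |g x|} ≤ ENNReal.ofReal t := by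
  obtain ⟨u, hu, hlim, hmem⟩ := exists_seq_tendsto_sInf hne ⟨0, fun s hs => hs.1⟩
  have hEq : {x | rearr g t < |g x|} = ⋃ n, {x | u n < |g x|} := by
    ext x
    simp only [mem_ofPred_eq, mem_iUnion]
    constructor
    · intro hx
      exact ((hlim.eventually_lt_const hx)).exists
    · rintro ⟨n, hn⟩
      exact (csInf_le ⟨0, fun s hs => hs.1⟩ (hmem n)).trans_lt hn
  rw [hEq, Monotone.measure_iUnion]
  · exact iSup_le fun n => (hmem n).2
  · intro m n hmn x hx
    exact (hu hmn).trans_lt hx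

lemma rearr_nonneg {X : Type*} [MeasureSpace X] (g : X → ℝ) (t : ℝ) : 0 ≤ rearr g t :=
  Real.sInf_nonneg fun _ hs => hs.1

lemma S0.rearr_set_nonempty {X : Type*} [MeasureSpace X] {g : X → ℝ} (hg : S0 g) {t : ℝ}
    (ht : 0 < t) : {s : ℝ | 0 ≤ s ∧ volume {x | s < |g x|} ≤ ENNReal.ofReal t}.Nonempty := by
  have hlim : Filter.Tendsto (fun n : ℕ => volume {x | (n : ℝ) + 1 < |g x|}) Filter.atTop
      (nhds (volume (⋂ n : ℕ, {x | (n : ℝ) + 1 < |g x|}))) := by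
    refine tendsto_measure_iInter_atTop (fun n => ?_) ?_ ⟨0, (hg.2 _ (by norm_num)).ne⟩
    · exact (measurableSet_lt measurable_const (by simpa using hg.1.norm)).nullMeasurableSet
    · intro m n hmn x hx
      have : (m : ℝ) ≤ n := by exact_mod_cast hmn
      simp only [mem_ofPred_eq] at hx ⊢
      linarith
  have hem : (⋂ n : ℕ, {x | (n : ℝ) + 1 < |g x|}) = ∅ := by
    refine eq_empty_of_forall_notMem fun x hx => ?_
    obtain ⟨n, hn⟩ := exists_nat_gt |g x|
    have := mem_iInter.1 hx n
    simp only [mem_ofPred_eq] at this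
    linarith
  rw [hem, measure_empty] at hlim
  obtain ⟨n, hn⟩ := (hlim.eventually_lt_const (ENNReal.ofReal_pos.2 ht)).exists
  exact ⟨n + 1, by positivity, hn.le⟩

section domination

variable {X : Type*} [MeasureSpace X] {g G : X → ℝ}

lemma volume_lt_abs_le_of_ae_le (h : ∀ᵐ x, |g x| ≤ |G x|) (s : ℝ) :
    volume {x | s < |g x|} ≤ volume {x | s < |G x|} :=
  measure_mono_ae (by filter_upwards [h] with x hx hs using lt_of_lt_of_le hs hx)

lemma rearr_set_nonempty_of_ae_le (hG : S0 G) (h : ∀ᵐ x, |g x| ≤ |G x|) {t : ℝ} (ht : 0 < t) :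
    {s : ℝ | 0 ≤ s ∧ volume {x | s < |g x|} ≤ ENNReal.ofReal t}.Nonempty :=
  (hG.rearr_set_nonempty ht).mono fun _ hs => ⟨hs.1, (volume_lt_abs_le_of_ae_le h _).trans hs.2⟩

lemma rearr_le_of_ae_le (hG : S0 G) (h : ∀ᵐ x, |g x| ≤ |G x|) {t : ℝ} (ht : 0 < t) :
    rearr g t ≤ rearr G t :=
  csInf_le_csInf ⟨0, fun _ hs => hs.1⟩ (hG.rearr_set_nonempty ht)
    fun _ hs => ⟨hs.1, (volume_lt_abs_le_of_ae_le h _).trans hs.2⟩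

lemma rearr_antitoneOn_of_ae_le (hG : S0 G) (h : ∀ᵐ x, |g x| ≤ |G x|) :
    AntitoneOn (rearr g) (Ioi 0) := fun _ ha _ _ hab =>
  csInf_le_csInf ⟨0, fun _ hs => hs.1⟩ (rearr_set_nonempty_of_ae_le hG h ha)
    fun _ hs => ⟨hs.1, hs.2.trans (ENNReal.ofReal_le_ofReal hab)⟩

lemma integrableOn_rearr_of_ae_le {p : ℝ} (hG : MemLorentz p 1 G) (h : ∀ᵐ x, |g x| ≤ |G x|) :
    IntegrableOn (fun t => (t ^ (1/p) * rearr g t) ^ (1:ℝ) / t) (Ioi (0:ℝ)) := by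
  refine Integrable.mono' hG.2 ?_ ?_
  · have h1 : AEMeasurable (rearr g) (volume.restrict (Ioi 0)) :=
      aemeasurable_restrict_of_antitoneOn measurableSet_Ioi (rearr_antitoneOn_of_ae_le hG.1 h)
    have h2 : AEMeasurable (fun t : ℝ => t ^ (1/p)) (volume.restrict (Ioi 0)) := by fun_prop
    have h3 := ((h2.mul h1).pow_const (1:ℝ)).div (aemeasurable_id (μ := volume.restrict (Ioi (0:ℝ))))
    exact h3.aestronglyMeasurable
  · filter_upwards [ae_restrict_mem measurableSet_Ioi] with t ht
    have ht0 : 0 < t := ht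
    have := rearr_le_of_ae_le hG.1 h ht0
    have h0 := rearr_nonneg g t
    rw [Real.rpow_one, Real.rpow_one, Real.norm_of_nonneg (by positivity)]
    gcongr

/-- One dyadic block of the Lorentz integral controls the rearrangement at the right end. -/
lemma rearr_mul_rpow_le_integral {p h : ℝ} (hp : 1 ≤ p) (hh : 0 < h) (hG : MemLorentz p 1 G)
    (hle : ∀ᵐ x, |g x| ≤ |G x|) :
    rearr g (h / 4) * h ^ (1/p) ≤
      8 * ∫ t in Ioc (h / 8) (h / 4), (t ^ (1/p) * rearr g t) ^ (1:ℝ) / t := by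
  have hsub : Ioc (h / 8) (h / 4) ⊆ Ioi 0 := fun t ht => lt_trans (by positivity) ht.1
  have hp0 : 0 < p := by linarith
  have hα : 1 / p ≤ 1 := by rw [div_le_one hp0]; exact hp
  have hα0 : 0 < 1 / p := by positivity
  have hr := rearr_nonneg g (h / 4)
  have hb : ∀ t ∈ Ioc (h / 8) (h / 4), rearr g (h / 4) * h ^ (1/p) / h ≤
      (t ^ (1/p) * rearr g t) ^ (1:ℝ) / t := by
    intro t ht
    have ht0 : 0 < t := hsub ht
    have h1 : rearr g (h / 4) ≤ rearr g t :=
      rearr_antitoneOn_of_ae_le hG.1 hle ht0 (show (0:ℝ) < h / 4 by positivity) ht.2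
    have h2 : h ^ (1/p - 1) ≤ t ^ (1/p - 1) :=
      Real.rpow_le_rpow_of_nonpos ht0 (by linarith [ht.2]) (by linarith)
    rw [Real.rpow_sub hh, Real.rpow_sub ht0, Real.rpow_one, Real.rpow_one] at h2
    rw [Real.rpow_one, mul_div_assoc, mul_comm (t ^ _), mul_div_assoc]
    gcongr
    exact rearr_nonneg g t
  have hint := (integrableOn_rearr_of_ae_le hG hle).mono_set hsub
  have := setIntegral_mono_on (μ := volume) (s := Ioc (h / 8) (h / 4))
    (f := fun _ => rearr g (h / 4) * h ^ (1/p) / h)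
    (integrableOn_const (by simp)) hint measurableSet_Ioc hb
  rw [setIntegral_const, smul_eq_mul, Measure.real, Real.volume_Ioc,
    ENNReal.toReal_ofReal (by linarith)] at this
  have h3 : (h / 4 - h / 8) * (rearr g (h / 4) * h ^ (1/p) / h) =
      rearr g (h / 4) * h ^ (1/p) / 8 := by field_simp; ring
  linarith

end domination

/-- Off a set of `y` of measure less than `h`, the sections `f(·, y)` are bounded by `M`. -/
def SectionBound (f : ℝ × ℝ → ℝ) (h M : ℝ) : Prop :=
  ∃ A : Set ℝ, MeasurableSet A ∧ volume Aᶜ < ENNReal.ofReal h ∧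
    ∀ᵐ y, ∀ᵐ x, y ∈ A → |f (x, y)| ≤ M

lemma SectionBound.mono {f : ℝ × ℝ → ℝ} {h M M' : ℝ} (H : SectionBound f h M) (hM : M ≤ M') :
    SectionBound f h M' := by
  obtain ⟨A, hA, hAv, H⟩ := H
  refine ⟨A, hA, hAv, ?_⟩
  filter_upwards [H] with y hy
  filter_upwards [hy] with x hx hyA using (hx hyA).trans hM

lemma SectionBound.swap_half {f : ℝ × ℝ → ℝ} {α h M : ℝ} (hf : Measurable f) (hα : 0 < α)
    (hh : 0 < h) (hfin : ∀ᵐ x : ℝ, lipSemiE α (fun y => f (x, y)) < ⊤)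
    (hne : {s : ℝ | 0 ≤ s ∧ volume {x : ℝ | s < |lipSemi α (fun y => f (x, y))|} ≤
      ENNReal.ofReal (h / 4)}.Nonempty)
    (H : SectionBound f h M) :
    SectionBound (fun z => f (z.2, z.1)) (h / 2)
      (M + rearr (fun x => lipSemi α (fun y => f (x, y))) (h / 4) * h ^ α) := by
  obtain ⟨A, hA, hAv, H⟩ := H
  set s := rearr (fun x => lipSemi α (fun y => f (x, y))) (h / 4) with hs
  have hv := volume_rearr_lt_le hne
  rw [← hs] at hv
  set B := toMeasurable volume {x : ℝ | s < |lipSemi α (fun y => f (x, y))|} with hB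
  refine ⟨Bᶜ, (measurableSet_toMeasurable _ _).compl, ?_, ?_⟩
  · rw [compl_compl, hB, measure_toMeasurable]
    exact hv.trans_lt ((ENNReal.ofReal_lt_ofReal_iff (by positivity)).2 (by linarith))
  have hmeas : MeasurableSet {z : ℝ × ℝ | z.1 ∈ A → |f (z.2, z.1)| ≤ M} :=
    (measurable_fst hA).imp (measurableSet_le (by fun_prop) (by fun_prop))
  have H' : ∀ᵐ x, ∀ᵐ y, y ∈ A → |f (x, y)| ≤ M := (Measure.ae_ae_comm hmeas).1 H
  filter_upwards [H', hfin] with x hx hxf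
  by_cases hxB : x ∈ B
  · exact ae_of_all _ fun y h => absurd hxB h
  have hle : lipSemi α (fun y => f (x, y)) ≤ s := by
    by_contra! hcon
    exact hxB (subset_toMeasurable _ _ (lt_of_lt_of_le hcon (le_abs_self _)))
  filter_upwards [ae_abs_le_of_lipSemi_le (by fun_prop) hα (rearr_nonneg _ _) hxf hle hAv hx]
    with y hy _ using hy

lemma abs_lipSemi_le_abs_lipNorm {α : ℝ} {φ : ℝ → ℝ} (h : MemLip α φ) :
    |lipSemi α φ| ≤ |lipNorm α φ| := by
  rw [lipSemi, lipNorm, abs_of_nonneg ENNReal.toReal_nonneg, abs_of_nonneg ENNReal.toReal_nonneg]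
  exact ENNReal.toReal_mono (ENNReal.add_lt_top.2 h).ne le_add_self

lemma ae_abs_le_abs_lipNorm {α : ℝ} {φ : ℝ → ℝ} (h : MemLip α φ) :
    ∀ᵐ x, |φ x| ≤ |lipNorm α φ| := by
  refine ae_abs_le_of_einf_le (abs_nonneg _) ?_
  rw [lipNorm, abs_of_nonneg ENNReal.toReal_nonneg,
    ENNReal.ofReal_toReal (ENNReal.add_lt_top.2 h).ne]
  exact le_self_add

lemma sectionBound_of_lipNorm {α ε H : ℝ} {f : ℝ × ℝ → ℝ}
    (hlip : ∀ᵐ y : ℝ, MemLip α (fun x => f (x, y)))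
    (hN : S0 (fun y => lipNorm α (fun x => f (x, y))))
    (hH : volume {y : ℝ | ε < |lipNorm α (fun x => f (x, y))|} < ENNReal.ofReal H) :
    SectionBound f H ε := by
  refine ⟨{y : ℝ | ε < |lipNorm α (fun x => f (x, y))|}ᶜ,
    (measurableSet_lt measurable_const (by simpa using hN.1.norm)).compl, by simpa using hH, ?_⟩
  filter_upwards [hlip] with y hy
  filter_upwards [ae_abs_le_abs_lipNorm hy] with x hx hyA
  exact hx.trans (not_lt.1 hyA)

lemma MemUp.swap {p : ℝ} {f : ℝ × ℝ → ℝ} (hf : MemUp p f) : MemUp p (fun z => f (z.2, z.1)) :=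
  ⟨hf.1.comp measurable_swap, hf.2.2.1, hf.2.1, hf.2.2.2.2, hf.2.2.2.1⟩

/-- The seminorm function `y ↦ ‖f(·, y)‖*_{Lip 1/p}`. -/
def sectionSemi (p : ℝ) (f : ℝ × ℝ → ℝ) (y : ℝ) : ℝ := lipSemi (1/p) (fun x => f (x, y))

/-- The part over `(a, ∞)` of the integral defining the `L^{p,1}` norm of `sectionSemi p f`. -/
def lorentzTail (p : ℝ) (f : ℝ × ℝ → ℝ) (a : ℝ) : ℝ :=
  ∫ t in Ioi a, (t ^ (1/p) * rearr (sectionSemi p f) t) ^ (1:ℝ) / t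

lemma MemUp.sectionSemi_le {p : ℝ} {f : ℝ × ℝ → ℝ} (hf : MemUp p f) :
    ∀ᵐ y : ℝ, |sectionSemi p f y| ≤ |lipNorm (1/p) (fun x => f (x, y))| := by
  filter_upwards [hf.2.1] with y hy using abs_lipSemi_le_abs_lipNorm hy

lemma lorentzIntegrand_nonneg (p : ℝ) (g : ℝ → ℝ) {t : ℝ} (ht : 0 < t) :
    0 ≤ (t ^ (1/p) * rearr g t) ^ (1:ℝ) / t := by
  have := rearr_nonneg g t
  positivity

lemma lorentzTail_nonneg (p : ℝ) (f : ℝ × ℝ → ℝ) {a : ℝ} (ha : 0 ≤ a) : 0 ≤ lorentzTail p f a :=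
  setIntegral_nonneg measurableSet_Ioi fun _ ht => lorentzIntegrand_nonneg p _ (ha.trans_lt ht)

lemma MemUp.lorentzTail_le {p : ℝ} {f : ℝ × ℝ → ℝ} (hf : MemUp p f) {a : ℝ} (ha : 0 ≤ a) :
    lorentzTail p f a ≤ lorentzNorm p 1 (sectionSemi p f) := by
  rw [lorentzNorm, one_div_one, Real.rpow_one]
  refine setIntegral_mono_set (integrableOn_rearr_of_ae_le hf.2.2.2.1 hf.sectionSemi_le) ?_
    (Ioi_subset_Ioi ha).eventuallyLE
  filter_upwards [ae_restrict_mem measurableSet_Ioi] with t ht using lorentzIntegrand_nonneg p _ ht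

lemma MemUp.rearr_add_lorentzTail_le {p h : ℝ} {f : ℝ × ℝ → ℝ} (hp : 1 ≤ p) (hf : MemUp p f)
    (hh : 0 < h) :
    rearr (sectionSemi p f) (h / 4) * h ^ (1/p) + 8 * lorentzTail p f (h / 4) ≤
      8 * lorentzTail p f (h / 8) := by
  have hint := integrableOn_rearr_of_ae_le hf.2.2.2.1 hf.sectionSemi_le
  have h1 := rearr_mul_rpow_le_integral hp hh hf.2.2.2.1 hf.sectionSemi_le
  have h2 : lorentzTail p f (h / 8) = (∫ t in Ioc (h / 8) (h / 4),
      (t ^ (1/p) * rearr (sectionSemi p f) t) ^ (1:ℝ) / t) + lorentzTail p f (h / 4) := by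
    rw [lorentzTail, lorentzTail, ← setIntegral_union (Ioc_disjoint_Ioi le_rfl) measurableSet_Ioi,
      Ioc_union_Ioi_eq_Ioi (by linarith)]
    · exact hint.mono_set fun t ht => show 0 < t from lt_trans (by positivity) ht.1
    · exact hint.mono_set fun t ht => show 0 < t from lt_trans (show 0 < h / 4 by positivity) ht
  linarith

lemma MemUp.sectionBound_half {p h M : ℝ} {f : ℝ × ℝ → ℝ} (hp : 1 ≤ p) (hf : MemUp p f)
    (hh : 0 < h)
    (H : SectionBound (fun z => f (z.2, z.1)) h
      (M + 8 * (lorentzTail p f (h / 4) + lorentzTail p (fun z => f (z.2, z.1)) (h / 4)))) :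
    SectionBound f (h / 2)
      (M + 8 * (lorentzTail p f (h / 8) + lorentzTail p (fun z => f (z.2, z.1)) (h / 8))) := by
  have hα : 0 < 1 / p := one_div_pos.2 (by linarith)
  have h1 := H.swap_half hf.swap.1 hα hh
    (hf.2.1.mono fun y hy => hy.2)
    (rearr_set_nonempty_of_ae_le hf.2.2.2.1.1 hf.sectionSemi_le (by linarith))
  refine SectionBound.mono h1 ?_
  have h2 := hf.rearr_add_lorentzTail_le hp hh
  have h3 := hf.swap.rearr_add_lorentzTail_le hp hh
  have h4 : 0 ≤ rearr (sectionSemi p (fun z => f (z.2, z.1))) (h / 4) * h ^ (1/p) :=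
    mul_nonneg (rearr_nonneg _ _) (by positivity)
  change _ + rearr (sectionSemi p f) (h / 4) * h ^ (1/p) ≤ _
  linarith

lemma MemUp.sectionBound_pow {p H ε : ℝ} {f : ℝ × ℝ → ℝ} (hp : 1 ≤ p) (hf : MemUp p f)
    (hH : 0 < H) (h1 : SectionBound f H ε) (h2 : SectionBound (fun z => f (z.2, z.1)) H ε)
    (n : ℕ) :
    SectionBound f (H / 2 ^ n) (ε + 8 * (lorentzTail p f (H / 2 ^ n / 4) +
      lorentzTail p (fun z => f (z.2, z.1)) (H / 2 ^ n / 4))) ∧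
    SectionBound (fun z => f (z.2, z.1)) (H / 2 ^ n) (ε + 8 * (lorentzTail p f (H / 2 ^ n / 4) +
      lorentzTail p (fun z => f (z.2, z.1)) (H / 2 ^ n / 4))) := by
  induction n with
  | zero =>
    have h3 := lorentzTail_nonneg p f (a := H / 2 ^ 0 / 4) (by positivity)
    have h4 := lorentzTail_nonneg p (fun z => f (z.2, z.1)) (a := H / 2 ^ 0 / 4) (by positivity)
    simp only [pow_zero, div_one] at h3 h4 ⊢
    exact ⟨h1.mono (by linarith), h2.mono (by linarith)⟩
  | succ n ih =>
    have e1 : H / 2 ^ (n + 1) = H / 2 ^ n / 2 := by rw [pow_succ, div_div]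
    have e2 : H / 2 ^ n / 2 / 4 = H / 2 ^ n / 8 := by ring
    rw [e1, e2]
    refine ⟨hf.sectionBound_half hp (by positivity) ih.2, ?_⟩
    have := hf.swap.sectionBound_half (M := ε) hp (h := H / 2 ^ n) (by positivity)
    rw [add_comm (lorentzTail p f _)] at ih ⊢
    exact this ih.1

lemma MemUp.exists_sectionBound {p ε : ℝ} {f : ℝ × ℝ → ℝ} (hf : MemUp p f) (hε : 0 < ε) :
    ∃ H₀ : ℝ, ∀ H ≥ H₀, SectionBound f H ε := by
  have hfin := hf.2.2.2.1.1.2 ε hε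
  refine ⟨(volume {y : ℝ | ε < |lipNorm (1/p) (fun x => f (x, y))|}).toReal + 1, fun H hH => ?_⟩
  refine sectionBound_of_lipNorm hf.2.1 hf.2.2.2.1.1 ?_
  rw [ENNReal.lt_ofReal_iff_toReal_lt hfin.ne]
  linarith

lemma ae_ae_abs_le_of_sectionBound {f : ℝ × ℝ → ℝ} {M : ℝ} {h : ℕ → ℝ}
    (hh : Filter.Tendsto h Filter.atTop (nhds 0)) (H : ∀ n, SectionBound f (h n) M) :
    ∀ᵐ y, ∀ᵐ x, |f (x, y)| ≤ M := by
  rw [ae_iff]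
  refine le_antisymm ?_ zero_le
  have hlim : Filter.Tendsto (fun n => ENNReal.ofReal (h n)) Filter.atTop (nhds 0) := by
    simpa using ENNReal.tendsto_ofReal hh
  refine ge_of_tendsto' hlim fun n => ?_
  obtain ⟨A, -, hAv, hA⟩ := H n
  refine le_trans (measure_mono_ae ?_) hAv.le
  filter_upwards [hA] with y hy hyM hyA
  exact hyM (hy.mono fun x hx => hx hyA)

lemma MemUp.ae_abs_le {p : ℝ} {f : ℝ × ℝ → ℝ} (hp : 1 ≤ p) (hf : MemUp p f) :
    ∀ᵐ z : ℝ × ℝ, |f z| ≤ 8 * (lorentzNorm p 1 (sectionSemi p f) +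
      lorentzNorm p 1 (sectionSemi p (fun z => f (z.2, z.1)))) := by
  set S := lorentzNorm p 1 (sectionSemi p f) +
      lorentzNorm p 1 (sectionSemi p (fun z => f (z.2, z.1))) with hS
  have key : ∀ ε > 0, ∀ᵐ z : ℝ × ℝ, |f z| ≤ ε + 8 * S := by
    intro ε hε
    obtain ⟨H₁, h1⟩ := hf.exists_sectionBound hε
    obtain ⟨H₂, h2⟩ := hf.swap.exists_sectionBound hε
    set H := max 1 (max H₁ H₂) with hHdef
    have hH : 0 < H := lt_of_lt_of_le one_pos (le_max_left _ _)
    have hb := hf.sectionBound_pow hp hH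
      (h1 H ((le_max_left _ _).trans (le_max_right _ _)))
      (h2 H ((le_max_right _ _).trans (le_max_right _ _)))
    have hlim : Filter.Tendsto (fun n : ℕ => H / 2 ^ n) Filter.atTop (nhds 0) := by
      have := (tendsto_pow_atTop_nhds_zero_of_lt_one (r := (1/2 : ℝ)) (by norm_num)
        (by norm_num)).const_mul H
      simpa [div_eq_mul_inv] using this
    have hae : ∀ᵐ y, ∀ᵐ x, |f (x, y)| ≤ ε + 8 * S := by
      refine ae_ae_abs_le_of_sectionBound hlim fun n => (hb n).1.mono ?_
      have h3 := hf.lorentzTail_le (a := H / 2 ^ n / 4) (by positivity)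
      have h4 := hf.swap.lorentzTail_le (a := H / 2 ^ n / 4) (by positivity)
      linarith
    have hmeas : MeasurableSet {z : ℝ × ℝ | |f z| ≤ ε + 8 * S} :=
      measurableSet_le (by simpa using hf.1.norm) measurable_const
    have hmeas' : MeasurableSet {z : ℝ × ℝ | |f (z.2, z.1)| ≤ ε + 8 * S} := measurable_swap hmeas
    rw [Measure.volume_eq_prod, Measure.ae_prod_iff_ae_ae hmeas]
    exact (Measure.ae_ae_comm hmeas').1 hae
  have hall : ∀ᵐ z : ℝ × ℝ, ∀ n : ℕ, |f z| ≤ 1 / ((n : ℝ) + 1) + 8 * S :=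
    ae_all_iff.2 fun n => key _ (by positivity)
  filter_upwards [hall] with z hz
  have hlim := (tendsto_one_div_add_atTop_nhds_zero_nat (𝕜 := ℝ)).add_const (8 * S)
  rw [zero_add] at hlim
  exact ge_of_tendsto' hlim hz

lemma MemUp.s0 {p : ℝ} {f : ℝ × ℝ → ℝ} (hf : MemUp p f) : S0 f := by
  refine ⟨hf.1, fun s hs => ?_⟩
  set E := {x : ℝ | s < |lipNorm (1/p) (fun y => f (x, y))|} with hE
  set F := {y : ℝ | s < |lipNorm (1/p) (fun x => f (x, y))|} with hF
  have hEm : MeasurableSet E :=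
    measurableSet_lt measurable_const (by simpa using hf.2.2.2.2.1.1.norm)
  have hFm : MeasurableSet F :=
    measurableSet_lt measurable_const (by simpa using hf.2.2.2.1.1.1.norm)
  have hm : MeasurableSet {z : ℝ × ℝ | s < |f z|} :=
    measurableSet_lt measurable_const (by simpa using hf.1.norm)
  have h1 : ∀ᵐ z : ℝ × ℝ, s < |f z| → z.1 ∈ E := by
    rw [Measure.volume_eq_prod, Measure.ae_prod_iff_ae_ae (hm.imp (measurable_fst hEm))]
    filter_upwards [hf.2.2.1] with x hx
    filter_upwards [ae_abs_le_abs_lipNorm hx] with y hy hs using lt_of_lt_of_le hs hy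
  have h2 : ∀ᵐ z : ℝ × ℝ, s < |f z| → z.2 ∈ F := by
    have hm2 := hm.imp (measurable_snd hFm)
    rw [Measure.volume_eq_prod, Measure.ae_prod_iff_ae_ae hm2]
    refine (Measure.ae_ae_comm (p := fun y x => s < |f (x, y)| → y ∈ F) (measurable_swap hm2)).1 ?_
    filter_upwards [hf.2.1] with y hy
    filter_upwards [ae_abs_le_abs_lipNorm hy] with x hx hs using lt_of_lt_of_le hs hx
  have h3 : volume {z : ℝ × ℝ | s < |f z|} ≤ volume (E ×ˢ F) :=
    measure_mono_ae (by filter_upwards [h1, h2] with z a b hz using ⟨a hz, b hz⟩)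
  refine h3.trans_lt ?_
  rw [Measure.volume_eq_prod, Measure.prod_prod]
  exact ENNReal.mul_lt_top (hf.2.2.2.2.1.2 s hs) (hf.2.2.2.1.1.2 s hs)

/-- If `1 ≤ p < ∞` and `f ∈ U_p(ℝ²)`, then `f ∈ S₀(ℝ²)`, `f` is
essentially bounded, and `‖f‖_∞ ≤ c (‖φ₁‖_{p,1} + ‖φ₂‖_{p,1})` with `c = c(p)`,
where `φ₁(y) = ‖f_y‖*_{Lip 1/p}` and `φ₂(x) = ‖f_x‖*_{Lip 1/p}`. -/
theorem stmt0 (p : ℝ) (hp : 1 ≤ p) :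
    ∃ c : ℝ, 0 < c ∧ ∀ f : ℝ × ℝ → ℝ, MemUp p f →
      S0 f ∧ eLpNorm f ⊤ volume < ⊤ ∧
      eLpNorm f ⊤ volume ≤ ENNReal.ofReal (c *
        (lorentzNorm p 1 (fun y => lipSemi (1/p) (fun x => f (x, y))) +
         lorentzNorm p 1 (fun x => lipSemi (1/p) (fun y => f (x, y))))) := by
  refine ⟨8, by norm_num, fun f hf => ?_⟩
  have hb : eLpNorm f ⊤ volume ≤ ENNReal.ofReal (8 *
      (lorentzNorm p 1 (fun y => lipSemi (1/p) (fun x => f (x, y))) +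
       lorentzNorm p 1 (fun x => lipSemi (1/p) (fun y => f (x, y))))) := by
    rw [eLpNorm_exponent_top]
    exact eLpNormEssSup_le_of_ae_bound (hf.ae_abs_le hp)
  exact ⟨hf.s0, hb.trans_lt ENNReal.ofReal_lt_top, hb⟩

end
end

section
/- Let E ⊂ ℝ² be a Lebesgue measurable set with 0 < mes₂(E) = t < ∞. For y ∈ ℝ let E(y) = {x ∈ ℝ : (x,y) ∈ E} and for x ∈ ℝ let E(x) = {y ∈ ℝ : (x,y) ∈ E}; let Π'' = {y : mes₁ E(y) > 0} (the essential projection of E onto the y-axis) and Π' = {x : mes₁ E(x) > 0} (the essential projection onto the x-axis). Then Π' and Π'' are measurable and at least one of them has one-dimensional measure ≥ √t, i.e. max(mes₁ Π', mes₁ Π'') ≥ √t. -/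
open MeasureTheory Set
open scoped ENNReal

noncomputable section

/-- A measurable set in a product has measure at most the product of the measures of its
essential projections. -/
theorem prod_le_mul_essential_projections {X Y : Type*} [MeasurableSpace X] [MeasurableSpace Y]
    (μ : Measure X) (ν : Measure Y) [SFinite μ] [SFinite ν] {E : Set (X × Y)}
    (hE : MeasurableSet E) :
    μ.prod ν E ≤ μ {x | 0 < ν {y | (x, y) ∈ E}} * ν {y | 0 < μ {x | (x, y) ∈ E}} := by
  have hA : MeasurableSet {x | 0 < ν {y | (x, y) ∈ E}} :=
    measurableSet_lt measurable_const (measurable_measure_prodMk_left hE)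
  have hB : MeasurableSet {y | 0 < μ {x | (x, y) ∈ E}} :=
    measurableSet_lt measurable_const (measurable_measure_prodMk_right hE)
  set A := {x | 0 < ν {y | (x, y) ∈ E}}
  set B := {y | 0 < μ {x | (x, y) ∈ E}}
  have hnull₁ : μ.prod ν (E ∩ Prod.fst ⁻¹' Aᶜ) = 0 := by
    rw [Measure.measure_prod_null (hE.inter (measurable_fst hA.compl))]
    refine Filter.Eventually.of_forall fun x => ?_
    by_cases hx : x ∈ A
    · exact measure_mono_null (fun y hy => hy.2 hx) measure_empty
    · exact measure_mono_null (fun y hy => hy.1) (nonpos_iff_eq_zero.mp (not_lt.mp hx))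
  have hnull₂ : μ.prod ν (E ∩ Prod.snd ⁻¹' Bᶜ) = 0 := by
    rw [Measure.prod_apply_symm (hE.inter (measurable_snd hB.compl))]
    refine lintegral_eq_zero_of_ae_eq_zero (Filter.Eventually.of_forall fun y => ?_)
    by_cases hy : y ∈ B
    · exact measure_mono_null (fun x hx => hx.2 hy) measure_empty
    · exact measure_mono_null (fun x hx => hx.1) (nonpos_iff_eq_zero.mp (not_lt.mp hy))
  have hcover : E ⊆ A ×ˢ B ∪ (E ∩ Prod.fst ⁻¹' Aᶜ ∪ E ∩ Prod.snd ⁻¹' Bᶜ) := by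
    intro z hz
    by_cases h₁ : z.1 ∈ A
    · by_cases h₂ : z.2 ∈ B
      · exact Or.inl ⟨h₁, h₂⟩
      · exact Or.inr (Or.inr ⟨hz, h₂⟩)
    · exact Or.inr (Or.inl ⟨hz, h₁⟩)
  calc μ.prod ν E ≤ μ.prod ν (A ×ˢ B) +
        μ.prod ν (E ∩ Prod.fst ⁻¹' Aᶜ ∪ E ∩ Prod.snd ⁻¹' Bᶜ) :=
        (measure_mono hcover).trans (measure_union_le _ _)
    _ = μ A * ν B := by
        rw [measure_union_null hnull₁ hnull₂, add_zero, Measure.prod_prod]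

/-- If `E ⊆ ℝ²` is measurable with `0 < mes₂ E = t < ∞`, then the
essential projections of `E` onto the two coordinate axes are measurable and at
least one of them has one-dimensional measure `≥ √t`. -/
theorem stmt7 (E : Set (ℝ × ℝ)) (hE : MeasurableSet E) (t : ℝ) (ht : 0 < t)
    (hm : volume E = ENNReal.ofReal t) :
    MeasurableSet {x : ℝ | 0 < volume {y : ℝ | (x, y) ∈ E}} ∧
    MeasurableSet {y : ℝ | 0 < volume {x : ℝ | (x, y) ∈ E}} ∧
    (ENNReal.ofReal (Real.sqrt t) ≤ volume {x : ℝ | 0 < volume {y : ℝ | (x, y) ∈ E}} ∨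
     ENNReal.ofReal (Real.sqrt t) ≤ volume {y : ℝ | 0 < volume {x : ℝ | (x, y) ∈ E}}) := by
  refine ⟨measurableSet_lt measurable_const (measurable_measure_prodMk_left hE),
    measurableSet_lt measurable_const (measurable_measure_prodMk_right hE), ?_⟩
  by_contra! h
  have hlt := ENNReal.mul_lt_mul h.1 h.2
  rw [← ENNReal.ofReal_mul (Real.sqrt_nonneg t), Real.mul_self_sqrt ht.le, ← hm] at hlt
  exact absurd (prod_le_mul_essential_projections volume volume hE) (not_le.mpr hlt)

end
end
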